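/- Let κ be a perfect field of characteristic 2 and let V be a finite-dimensional κ-vector space equipped with a nondegenerate symmetric bilinear form b. Then there exists a unique vector e ∈ V such that b(v, e)² = b(v, v) for every v ∈ V. Moreover, e = 0 if and only if b is alternating (i.e. b(v, v) = 0 for all v ∈ V). -/

import Mathlib

/-- Let `κ` be a perfect field of characteristic `2` and let `V` be a
finite-dimensional `κ`-vector space with a nondegenerate symmetric bilinear form `b`.
Then there is a unique vector `e ∈ V` with `b(v, e)² = b(v, v)` for every `v ∈ V`;
moreover `e = 0` if and only if `b` is alternating. -/
theorem existsUnique_char_vector_of_symm_bilin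
    {κ V : Type*} [Field κ] [CharP κ 2] [PerfectField κ]
    [AddCommGroup V] [Module κ V] [FiniteDimensional κ V]
    (b : LinearMap.BilinForm κ V)
    (hsymm : ∀ v w : V, b v w = b w v)
    (hnd : b.Nondegenerate) :
    (∃! e : V, ∀ v : V, (b v e) ^ 2 = b v v) ∧
    (∀ e : V, (∀ v : V, (b v e) ^ 2 = b v v) → (e = 0 ↔ ∀ v : V, b v v = 0)) := by
  have : Fact (Nat.Prime 2) := ⟨Nat.prime_two⟩
  have : ExpChar κ 2 := ExpChar.prime Nat.prime_two
  have : PerfectRing κ 2 := PerfectField.toPerfectRing 2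
  have h2 : (2 : κ) = 0 := CharTwo.two_eq_zero
  have inj : ∀ x y : κ, x ^ 2 = y ^ 2 → x = y := fun x y h =>
    injective_frobenius κ 2 (by simpa [frobenius_def] using h)
  have uniq : ∀ e e' : V, (∀ v, (b v e) ^ 2 = (b v e') ^ 2) → e = e' := by
    intro e e' h
    apply LinearMap.ker_eq_bot.mp hnd.ker_eq_bot
    ext v
    rw [hsymm e v, hsymm e' v]
    exact inj _ _ (h v)
  choose r hr using fun x : κ => surjective_frobenius κ 2 x
  simp only [frobenius_def] at hr
  let f : Module.Dual κ V :=
    { toFun := fun v => r (b v v)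
      map_add' := fun v w => by
        apply inj
        rw [add_sq, hr, hr, hr]
        simp only [map_add, LinearMap.add_apply]
        rw [hsymm w v]
        linear_combination (b v w - r (b v v) * r (b w w)) * h2
      map_smul' := fun c v => by
        apply inj
        simp only [RingHom.id_apply, smul_eq_mul]
        rw [mul_pow, hr, hr]
        simp only [map_smul, LinearMap.smul_apply, smul_eq_mul]
        ring }
  refine ⟨⟨(b.toDual hnd).symm f, ?_, ?_⟩, ?_⟩
  · intro v
    rw [hsymm, LinearMap.BilinForm.apply_toDual_symm_apply]
    exact hr _
  · intro e he
    apply uniq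
    intro v
    rw [he v, hsymm v ((b.toDual hnd).symm f), LinearMap.BilinForm.apply_toDual_symm_apply]
    exact (hr _).symm
  · intro e he
    constructor
    · rintro rfl v
      rw [← he v]
      simp
    · intro h
      apply uniq
      intro v
      rw [he v, h v]
      simp
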